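/- arXiv:0909.5586 — 5 statements merged into one kernel-verified Lean document; each statement's English description precedes it below -/
import Mathlib

section
/- Let A be a commutative unital ℂ-algebra, let X be a p×p matrix over A, and let χ be the character of a finite-dimensional irreducible complex representation of S_p. Then column-imm_χ X = row-imm_χ X = double-imm_χ X = symm-imm_χ X. -/
open CategoryTheory

/-- column immanant: `Σ_{σ∈S_p} χ(σ) X_{σ(1),1} X_{σ(2),2} ⋯ X_{σ(p),p}`. -/
noncomputable def columnImm {p : ℕ} {A : Type*} [Ring A] [Algebra ℂ A]
    (χ : Equiv.Perm (Fin p) → ℂ) (X : Matrix (Fin p) (Fin p) A) : A :=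
  ∑ σ : Equiv.Perm (Fin p), χ σ • (List.ofFn fun a : Fin p => X (σ a) a).prod

/-- row immanant: `Σ_{σ∈S_p} χ(σ⁻¹) X_{1,σ(1)} ⋯ X_{p,σ(p)}`. -/
noncomputable def rowImm {p : ℕ} {A : Type*} [Ring A] [Algebra ℂ A]
    (χ : Equiv.Perm (Fin p) → ℂ) (X : Matrix (Fin p) (Fin p) A) : A :=
  ∑ σ : Equiv.Perm (Fin p), χ σ⁻¹ • (List.ofFn fun a : Fin p => X a (σ a)).prod

/-- double immanant:
`(χ(1)/p!) Σ_{σ,σ'∈S_p} χ(σ) χ(σ'⁻¹) X_{σ(1),σ'(1)} ⋯ X_{σ(p),σ'(p)}`. -/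
noncomputable def doubleImm {p : ℕ} {A : Type*} [Ring A] [Algebra ℂ A]
    (χ : Equiv.Perm (Fin p) → ℂ) (X : Matrix (Fin p) (Fin p) A) : A :=
  ∑ σ : Equiv.Perm (Fin p), ∑ σ' : Equiv.Perm (Fin p),
    (χ 1 / (p.factorial : ℂ) * χ σ * χ σ'⁻¹) •
      (List.ofFn fun a : Fin p => X (σ a) (σ' a)).prod

/-- symmetrized immanant:
`(1/p!) Σ_{σ,σ'∈S_p} χ(σσ'⁻¹) X_{σ(1),σ'(1)} ⋯ X_{σ(p),σ'(p)}`. -/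
noncomputable def symmImm {p : ℕ} {A : Type*} [Ring A] [Algebra ℂ A]
    (χ : Equiv.Perm (Fin p) → ℂ) (X : Matrix (Fin p) (Fin p) A) : A :=
  ∑ σ : Equiv.Perm (Fin p), ∑ σ' : Equiv.Perm (Fin p),
    ((p.factorial : ℂ)⁻¹ * χ (σ * σ'⁻¹)) •
      (List.ofFn fun a : Fin p => X (σ a) (σ' a)).prod

namespace FDRep

variable {k G : Type*} [Field k] [IsAlgClosed k] [Group G]

/-- Schur's lemma: a linear map commuting with an irreducible representation is a scalar. -/
theorem exists_eq_smul_id_of_commute (V : FDRep k G) [Simple V] (f : V →ₗ[k] V)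
    (hf : ∀ g, Commute f (V.ρ g)) : ∃ c : k, f = c • LinearMap.id := by
  let F : V ⟶ V := ⟨InducedCategory.homMk (ModuleCat.ofHom f), fun g => by
    ext x
    exact LinearMap.congr_fun (hf g).eq x⟩
  obtain ⟨c, hc⟩ := endomorphism_simple_eq_smul_id k F
  refine ⟨c, LinearMap.ext fun x => ?_⟩
  have h := congrArg (fun φ : V ⟶ V => φ.hom.hom.hom x) hc
  exact h.symm

/-- The character of an irreducible representation is an idempotent for convolution, up to the
factor `|G| / χ(1)`. -/
theorem char_one_mul_sum_char_mul_char_inv (V : FDRep k G) [Simple V] [Fintype G]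
    [Invertible (Nat.card G : k)] (h : G) :
    V.character 1 * ∑ g, V.character (h * g) * V.character g⁻¹ =
      (Nat.card G : k) * V.character h := by
  classical
  obtain ⟨c, hc⟩ := V.exists_eq_smul_id_of_commute (∑ g, V.character g⁻¹ • V.ρ g) fun t => by
    rw [commute_iff_eq, Finset.sum_mul, Finset.mul_sum,
      ← (MulAut.conj t).toEquiv.sum_comp]
    refine Finset.sum_congr rfl fun g _ => ?_
    have hχ : V.character (t * g * t⁻¹)⁻¹ = V.character g⁻¹ := by
      rw [← V.char_conj g⁻¹ t]
      group
    simp only [MulEquiv.toEquiv_eq_coe, EquivLike.coe_coe, MulAut.conj_apply, hχ]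
    rw [smul_mul_assoc, mul_smul_comm, ← map_mul, ← map_mul, inv_mul_cancel_right]
  have htr (t : G) : ∑ g, V.character (t * g) * V.character g⁻¹ = c * V.character t := by
    have := congrArg (fun f => LinearMap.trace k V (V.ρ t * f)) hc
    simp only [Finset.mul_sum, mul_smul_comm, ← map_mul, map_sum, map_smul, smul_eq_mul] at this
    simpa only [character, mul_comm, ← Module.End.one_eq_id, mul_one] using this
  have horth : ∑ g, V.character g * V.character g⁻¹ = (Nat.card G : k) := by
    have := V.char_orthonormal V
    rw [if_pos ⟨Iso.refl V⟩, inv_mul_eq_iff_eq_mul₀ (Invertible.ne_zero _)] at this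
    simpa using this
  have hone := htr 1
  simp only [one_mul, horth] at hone
  rw [htr, hone]
  ring

end FDRep

section Immanants

variable {p : ℕ} {A : Type*} [CommRing A]
  (χ : Equiv.Perm (Fin p) → ℂ) (X : Matrix (Fin p) (Fin p) A)

theorem prod_ofFn_perm_perm (σ τ : Equiv.Perm (Fin p)) :
    (List.ofFn fun a => X (σ a) (τ a)).prod =
      (List.ofFn fun a => X ((σ * τ⁻¹) a) a).prod := by
  simp only [List.prod_ofFn]
  rw [← Equiv.prod_comp τ fun a => X ((σ * τ⁻¹) a) a]
  simp

variable [Algebra ℂ A]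

theorem columnImm_eq_rowImm : columnImm χ X = rowImm χ X := by
  unfold columnImm rowImm
  refine Fintype.sum_equiv (Equiv.inv _) _ _ fun σ => ?_
  have h := prod_ofFn_perm_perm X 1 σ⁻¹
  simp only [Equiv.Perm.one_apply, one_mul, inv_inv] at h
  simp only [Equiv.inv_apply, inv_inv, h]

theorem sum_sum_smul_prod_ofFn (c : Equiv.Perm (Fin p) → Equiv.Perm (Fin p) → ℂ) :
    ∑ σ, ∑ τ, c σ τ • (List.ofFn fun a => X (σ a) (τ a)).prod =
      ∑ σ, (∑ τ, c (σ * τ) τ) • (List.ofFn fun a => X (σ a) a).prod := by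
  simp only [Finset.sum_smul]
  rw [Finset.sum_comm]
  conv_rhs => rw [Finset.sum_comm]
  refine Finset.sum_congr rfl fun τ _ => Fintype.sum_equiv (Equiv.mulRight τ⁻¹) _ _ fun σ => ?_
  rw [prod_ofFn_perm_perm]
  simp

theorem symmImm_eq_columnImm : symmImm χ X = columnImm χ X := by
  unfold symmImm columnImm
  rw [sum_sum_smul_prod_ofFn X fun σ τ => (p.factorial : ℂ)⁻¹ * χ (σ * τ⁻¹)]
  simp [Fintype.card_perm, Nat.factorial_ne_zero]

theorem doubleImm_character_eq_columnImm (W : FDRep ℂ (Equiv.Perm (Fin p))) [Simple W] :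
    doubleImm W.character X = columnImm W.character X := by
  have hcard : (Nat.card (Equiv.Perm (Fin p)) : ℂ) = p.factorial := by
    simp [Nat.card_eq_fintype_card, Fintype.card_perm]
  have hp : (p.factorial : ℂ) ≠ 0 := by exact_mod_cast p.factorial_ne_zero
  have : Invertible (Nat.card (Equiv.Perm (Fin p)) : ℂ) := invertibleOfNonzero (hcard ▸ hp)
  unfold doubleImm columnImm
  rw [sum_sum_smul_prod_ofFn X fun σ τ =>
    W.character 1 / (p.factorial : ℂ) * W.character σ * W.character τ⁻¹]
  refine Finset.sum_congr rfl fun σ _ => ?_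
  congr 1
  have h := W.char_one_mul_sum_char_mul_char_inv σ
  rw [hcard] at h
  simp only [mul_assoc]
  rw [← Finset.mul_sum, div_mul_eq_mul_div, h, mul_div_cancel_left₀ _ hp]

end Immanants

/-- For a commutative unital `ℂ`-algebra `A`, a `p×p` matrix `X` over `A`, and `χ` the
character of a finite-dimensional irreducible complex representation of `S_p`, the four
versions of the immanant of `X` coincide. -/
theorem stmt0 {p : ℕ} {A : Type*} [CommRing A] [Algebra ℂ A]
    (W : FDRep ℂ (Equiv.Perm (Fin p))) [Simple W]
    (X : Matrix (Fin p) (Fin p) A) :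
    columnImm W.character X = rowImm W.character X ∧
    rowImm W.character X = doubleImm W.character X ∧
    doubleImm W.character X = symmImm W.character X := by
  rw [← columnImm_eq_rowImm, doubleImm_character_eq_columnImm, symmImm_eq_columnImm]
  exact ⟨rfl, rfl, rfl⟩
end

section
/- Let A be a commutative unital ℂ-algebra, let X be an n×n' matrix and Y an n'×n'' matrix over A, and let χ be the character of a finite-dimensional irreducible complex representation of S_p. Then for all sequences I ∈ {1,…,n}^p and K ∈ {1,…,n''}^p: column-imm_χ (XY)_{IK} = (χ(1)/p!) · Σ_{J∈{1,…,n'}^p} column-imm_χ X_{IJ} · column-imm_χ Y_{JK} (a Cauchy–Binet type identity for immanants; since A is commutative all versions of the immanant coincide). -/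
open CategoryTheory

universe u v

/-- **Schur's lemma**: a linear endomorphism commuting with an irreducible representation over an
algebraically closed field is a scalar. -/
theorem FDRep.exists_eq_smul_id_of_commute_s2 {k : Type u} [Field k] [IsAlgClosed k] {G : Type v}
    [Group G] (W : FDRep k G) [Simple W] (T : W →ₗ[k] W) (hT : ∀ g, T ∘ₗ W.ρ g = W.ρ g ∘ₗ T) :
    ∃ c : k, T = c • LinearMap.id := by
  let f : W ⟶ W := ⟨InducedCategory.homMk (ModuleCat.ofHom T), fun g => by
    ext x
    exact LinearMap.congr_fun (hT g) x⟩
  obtain ⟨c, hc⟩ := endomorphism_simple_eq_smul_id k f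
  exact ⟨c, congrArg (fun h : W ⟶ W => h.hom.hom.hom) hc.symm⟩

/-- The convolution square of an irreducible character, times its degree, is the order of the
group times the character. -/
theorem FDRep.char_one_mul_sum_char_mul_char {G : Type v} [Group G] [Fintype G]
    (W : FDRep ℂ G) [Simple W] (g : G) :
    W.character 1 * ∑ h : G, W.character (g * h⁻¹) * W.character h =
      (Fintype.card G : ℂ) * W.character g := by
  classical
  have hT : ∀ g, (∑ h : G, W.character h • W.ρ h⁻¹) ∘ₗ W.ρ g =
      W.ρ g ∘ₗ (∑ h : G, W.character h • W.ρ h⁻¹) := by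
    intro g
    simp only [← Module.End.mul_eq_comp, Finset.sum_mul, Finset.mul_sum, smul_mul_assoc,
      mul_smul_comm, ← map_mul]
    refine Fintype.sum_equiv (MulAut.conj g⁻¹).toEquiv _ _ fun h => ?_
    rw [MulEquiv.toEquiv_eq_coe, MulEquiv.coe_toEquiv, MulAut.conj_apply, FDRep.char_conj]
    congr 2
    group
  obtain ⟨c, hc⟩ := W.exists_eq_smul_id_of_commute_s2 _ hT
  have hconv : ∀ g, ∑ h : G, W.character (g * h⁻¹) * W.character h = c * W.character g := by
    intro g
    have := congrArg (fun T : W →ₗ[ℂ] W => LinearMap.trace ℂ W (W.ρ g * T)) hc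
    simp only [Finset.mul_sum, mul_smul_comm, ← map_mul, map_sum, map_smul, smul_eq_mul] at this
    rw [← Module.End.one_eq_id, mul_one] at this
    simpa only [FDRep.character, mul_comm] using this
  have hcard : (Nat.card G : ℂ) ≠ 0 := Nat.cast_ne_zero.2 Nat.card_pos.ne'
  let _ : Invertible (Nat.card G : ℂ) := invertibleOfNonzero hcard
  have horth := FDRep.char_orthonormal W W
  rw [if_pos ⟨Iso.refl W⟩, inv_mul_eq_iff_eq_mul₀ hcard, mul_one] at horth
  have hone : c * W.character 1 = Fintype.card G := by
    rw [← hconv 1, ← Nat.card_eq_fintype_card, ← horth]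
    simp only [one_mul, mul_comm]
  rw [hconv, ← hone]
  ring

theorem columnImm_eq_sum_prod {p : ℕ} {A : Type*} [CommRing A] [Algebra ℂ A]
    (χ : Equiv.Perm (Fin p) → ℂ) (X : Matrix (Fin p) (Fin p) A) :
    columnImm χ X = ∑ σ : Equiv.Perm (Fin p), χ σ • ∏ a, X (σ a) a := by
  simp only [columnImm, List.prod_ofFn]

/-- Summing a product of two monomials over all middle index sequences gives a monomial of the
product matrix. -/
theorem sum_prod_mul_prod_eq_prod_mul {p : ℕ} {m n l A : Type*} [Fintype n] [DecidableEq n]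
    [CommRing A] (X : Matrix m n A) (Y : Matrix n l A) (I : Fin p → m) (K : Fin p → l)
    (σ τ : Equiv.Perm (Fin p)) :
    ∑ J : Fin p → n, (∏ a, X (I (σ a)) (J a)) * ∏ a, Y (J (τ a)) (K a) =
      ∏ a, (X * Y) (I ((σ * τ) a)) (K a) := by
  simp only [Matrix.mul_apply, Finset.prod_univ_sum, Fintype.piFinset_univ]
  refine Fintype.sum_equiv (τ.symm.arrowCongr (Equiv.refl n)) _ _ fun J => ?_
  rw [← Equiv.prod_comp τ fun a => X (I (σ a)) (J a), ← Finset.prod_mul_distrib]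
  simp

/-- Cauchy–Binet for arbitrary coefficient functions: the product of two immanants, summed over
the middle index sequences, is the immanant of the convolution. -/
theorem sum_columnImm_mul_columnImm {p : ℕ} {m n l A : Type*} [Fintype n] [DecidableEq n]
    [CommRing A] [Algebra ℂ A] (χ ψ : Equiv.Perm (Fin p) → ℂ) (X : Matrix m n A)
    (Y : Matrix n l A) (I : Fin p → m) (K : Fin p → l) :
    ∑ J : Fin p → n, columnImm χ (X.submatrix I J) * columnImm ψ (Y.submatrix J K) =
      columnImm (fun π => ∑ τ, χ (π * τ⁻¹) * ψ τ) ((X * Y).submatrix I K) := by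
  simp only [columnImm_eq_sum_prod, Matrix.submatrix_apply, Finset.sum_mul_sum,
    smul_mul_smul_comm, Finset.sum_smul]
  rw [Finset.sum_comm]
  simp only [Finset.sum_comm (s := (Finset.univ : Finset (Fin p → n))), ← Finset.smul_sum,
    sum_prod_mul_prod_eq_prod_mul]
  rw [Finset.sum_comm]
  conv_rhs => rw [Finset.sum_comm]
  refine Finset.sum_congr rfl fun τ _ => ?_
  refine Fintype.sum_equiv (Equiv.mulRight τ) _ _ fun σ => ?_
  simp

/-- Cauchy–Binet type identity for immanants: for a commutative unital `ℂ`-algebra `A`,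
matrices `X : n×n'`, `Y : n'×n''` over `A`, `χ` the character of a finite-dimensional
irreducible complex representation of `S_p`, and sequences `I ∈ [n]^p`, `K ∈ [n'']^p`:
`imm_χ (XY)_{IK} = (χ(1)/p!) Σ_{J∈[n']^p} imm_χ X_{IJ} · imm_χ Y_{JK}`. -/
theorem stmt2 {p n n' n'' : ℕ} {A : Type*} [CommRing A] [Algebra ℂ A]
    (W : FDRep ℂ (Equiv.Perm (Fin p))) [Simple W]
    (X : Matrix (Fin n) (Fin n') A) (Y : Matrix (Fin n') (Fin n'') A)
    (I : Fin p → Fin n) (K : Fin p → Fin n'') :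
    columnImm W.character ((X * Y).submatrix I K) =
      (W.character 1 / (p.factorial : ℂ)) •
        ∑ J : Fin p → Fin n',
          columnImm W.character (X.submatrix I J) *
            columnImm W.character (Y.submatrix J K) := by
  rw [sum_columnImm_mul_columnImm]
  simp only [columnImm, Finset.smul_sum, smul_smul]
  refine Finset.sum_congr rfl fun π _ => ?_
  congr 1
  rw [div_mul_eq_mul_div, W.char_one_mul_sum_char_mul_char, Fintype.card_perm, Fintype.card_fin,
    mul_div_cancel_left₀ _ (Nat.cast_ne_zero.2 p.factorial_ne_zero)]
end

section
/- Let A be an associative unital ℂ-algebra (not necessarily commutative) and X an n×n matrix over A. Then preimm_p X = (1/p!) Σ_{I∈{1,…,n}^p} symm-preimm X_{II} commutes with σ⊗1 in ℂS_p ⊗_ℂ A for every σ ∈ S_p. -/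
open scoped TensorProduct

/-- The group algebra `ℂS_p`. -/
abbrev SA (p : ℕ) := MonoidAlgebra ℂ (Equiv.Perm (Fin p))

/-- A permutation `σ`, viewed as an element of the group algebra `ℂS_p`. -/
noncomputable def perm {p : ℕ} (σ : Equiv.Perm (Fin p)) : SA p :=
  MonoidAlgebra.of ℂ (Equiv.Perm (Fin p)) σ

/-- symmetrized preimmanant:
`(1/p!) Σ_{σ,σ'∈S_p} σσ'⁻¹ ⊗ X_{σ(1),σ'(1)} ⋯ X_{σ(p),σ'(p)}` in `ℂS_p ⊗ A`. -/
noncomputable def symmPreimm {p : ℕ} {A : Type*} [Ring A] [Algebra ℂ A]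
    (X : Matrix (Fin p) (Fin p) A) : SA p ⊗[ℂ] A :=
  ((p.factorial : ℂ))⁻¹ • ∑ σ : Equiv.Perm (Fin p), ∑ σ' : Equiv.Perm (Fin p),
    perm (σ * σ'⁻¹) ⊗ₜ[ℂ] (List.ofFn fun a : Fin p => X (σ a) (σ' a)).prod

/-- `preimm_p X = (1/p!) Σ_{I∈[n]^p} symm-preimm X_{II}`. -/
noncomputable def preimmP (p : ℕ) {n : ℕ} {A : Type*} [Ring A] [Algebra ℂ A]
    (X : Matrix (Fin n) (Fin n) A) : SA p ⊗[ℂ] A :=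
  ((p.factorial : ℂ))⁻¹ • ∑ I : Fin p → Fin n, symmPreimm (X.submatrix I I)

theorem perm_tmul_one_mul_symmPreimm {p : ℕ} {A : Type*} [Ring A] [Algebra ℂ A]
    (X : Matrix (Fin p) (Fin p) A) (τ : Equiv.Perm (Fin p)) :
    (perm τ ⊗ₜ[ℂ] (1 : A)) * symmPreimm (X.submatrix τ τ) =
      symmPreimm X * (perm τ ⊗ₜ[ℂ] (1 : A)) := by
  simp only [symmPreimm, mul_smul_comm, smul_mul_assoc, Finset.mul_sum, Finset.sum_mul]
  congr 1
  refine Fintype.sum_equiv (Equiv.mulLeft τ) _ _ fun σ =>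
    Fintype.sum_equiv (Equiv.mulLeft τ) _ _ fun σ' => ?_
  simp [perm, mul_assoc]

/-- `preimm_p X` commutes with `σ ⊗ 1` in `ℂS_p ⊗ A` for every `σ ∈ S_p`. -/
theorem stmt6 {p n : ℕ} {A : Type*} [Ring A] [Algebra ℂ A]
    (X : Matrix (Fin n) (Fin n) A) (σ : Equiv.Perm (Fin p)) :
    Commute (perm σ ⊗ₜ[ℂ] (1 : A)) (preimmP p X) := by
  refine Commute.smul_right ?_ _
  rw [Commute, SemiconjBy, Finset.mul_sum, Finset.sum_mul]
  refine Fintype.sum_equiv (Equiv.arrowCongr σ (Equiv.refl (Fin n))) _ _ fun I => ?_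
  rw [← perm_tmul_one_mul_symmPreimm, Matrix.submatrix_submatrix]
  congr <;> ext <;> simp
end

section
/- Let A be an associative unital ℂ-algebra (not necessarily commutative), X an n×n matrix over A, and g ∈ GL_n(ℂ). Let gXg⁻¹ denote the n×n matrix over A with entries (gXg⁻¹)_{ij} = Σ_{k,l} g_{ik} (g⁻¹)_{lj} X_{kl} (complex scalars acting on A). Then preimm_p (gXg⁻¹) = preimm_p X in ℂS_p ⊗_ℂ A. -/
open scoped TensorProduct

/-- The matrix `gXg⁻¹` with entries `Σ_{k,l} g_{ik} (g⁻¹)_{lj} • X_{kl}`. -/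
noncomputable def conjMat {n : ℕ} {A : Type*} [Ring A] [Algebra ℂ A]
    (g : Matrix.GeneralLinearGroup (Fin n) ℂ) (X : Matrix (Fin n) (Fin n) A) :
    Matrix (Fin n) (Fin n) A :=
  Matrix.of fun i j => ∑ k : Fin n, ∑ l : Fin n,
    ((g : Matrix (Fin n) (Fin n) ℂ) i k * ((g⁻¹ : Matrix.GeneralLinearGroup (Fin n) ℂ) :
      Matrix (Fin n) (Fin n) ℂ) l j) • X k l

/-- Summing over the indices `I` leaves only the product of the entries of `h * g`. -/
theorem sum_prod_mul_prod_eq_prod_mul_apply {p n : ℕ} (g h : Matrix (Fin n) (Fin n) ℂ)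
    (σ σ' : Equiv.Perm (Fin p)) (J : Fin p → Fin n × Fin n) :
    ∑ I : Fin p → Fin n, ∏ a, (g (I (σ a)) (J a).1 * h (J a).2 (I (σ' a))) =
      ∏ b, (h * g) (J (σ'⁻¹ b)).2 (J (σ⁻¹ b)).1 := by
  simp only [Matrix.mul_apply, Finset.prod_univ_sum, Fintype.piFinset_univ]
  refine Finset.sum_congr rfl fun I _ => ?_
  rw [Finset.prod_mul_distrib, Finset.prod_mul_distrib, mul_comm]
  congr 1
  · simpa using Equiv.prod_comp σ' fun b => h (J (σ'⁻¹ b)).2 (I b)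
  · simpa using Equiv.prod_comp σ fun b => g (I b) (J (σ⁻¹ b)).1

theorem prod_ofFn_conjMat {p n : ℕ} {A : Type*} [Ring A] [Algebra ℂ A]
    (g : Matrix.GeneralLinearGroup (Fin n) ℂ) (X : Matrix (Fin n) (Fin n) A)
    (K L : Fin p → Fin n) :
    (List.ofFn fun a => conjMat g X (K a) (L a)).prod =
      ∑ J : Fin p → Fin n × Fin n,
        (∏ a, ((g : Matrix (Fin n) (Fin n) ℂ) (K a) (J a).1 *
          ((g⁻¹ : Matrix.GeneralLinearGroup (Fin n) ℂ) : Matrix (Fin n) (Fin n) ℂ)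
            (J a).2 (L a))) •
        (List.ofFn fun a => X (J a).1 (J a).2).prod := by
  simp only [conjMat, Matrix.of_apply, ← Fintype.sum_prod_type',
    ← MultilinearMap.mkPiAlgebraFin_apply (R := ℂ), MultilinearMap.map_sum,
    MultilinearMap.map_smul_univ]

theorem sum_prod_ofFn_conjMat {p n : ℕ} {A : Type*} [Ring A] [Algebra ℂ A]
    (g : Matrix.GeneralLinearGroup (Fin n) ℂ) (X : Matrix (Fin n) (Fin n) A)
    (σ σ' : Equiv.Perm (Fin p)) :
    ∑ I : Fin p → Fin n, (List.ofFn fun a => conjMat g X (I (σ a)) (I (σ' a))).prod =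
      ∑ J : Fin p → Fin n × Fin n,
        (∏ b, (1 : Matrix (Fin n) (Fin n) ℂ) (J (σ'⁻¹ b)).2 (J (σ⁻¹ b)).1) •
        (List.ofFn fun a => X (J a).1 (J a).2).prod := by
  simp only [prod_ofFn_conjMat g X (fun _ => _) (fun _ => _)]
  rw [Finset.sum_comm]
  refine Finset.sum_congr rfl fun J _ => ?_
  rw [← Finset.sum_smul, sum_prod_mul_prod_eq_prod_mul_apply, ← Units.val_mul, inv_mul_cancel,
    Units.val_one]

theorem conjMat_one {n : ℕ} {A : Type*} [Ring A] [Algebra ℂ A]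
    (X : Matrix (Fin n) (Fin n) A) : conjMat 1 X = X := by
  ext i j
  simp [conjMat, Matrix.one_apply, ite_smul]

theorem preimmP_eq_sum_perm (p : ℕ) {n : ℕ} {A : Type*} [Ring A] [Algebra ℂ A]
    (X : Matrix (Fin n) (Fin n) A) :
    preimmP p X = ((p.factorial : ℂ))⁻¹ • ((p.factorial : ℂ))⁻¹ •
      ∑ σ : Equiv.Perm (Fin p), ∑ σ' : Equiv.Perm (Fin p), perm (σ * σ'⁻¹) ⊗ₜ[ℂ]
        ∑ I : Fin p → Fin n, (List.ofFn fun a => X (I (σ a)) (I (σ' a))).prod := by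
  simp only [preimmP, symmPreimm, Matrix.submatrix_apply, ← Finset.smul_sum,
    TensorProduct.tmul_sum]
  rw [Finset.sum_comm]
  simp only [Finset.sum_comm (s := (Finset.univ : Finset (Fin p → Fin n)))]

/-- `preimm_p` is invariant under conjugation by `g ∈ GL_n(ℂ)`. -/
theorem stmt7 {p n : ℕ} {A : Type*} [Ring A] [Algebra ℂ A]
    (g : Matrix.GeneralLinearGroup (Fin n) ℂ) (X : Matrix (Fin n) (Fin n) A) :
    preimmP p (conjMat g X) = preimmP p X := by
  conv_rhs => rw [← conjMat_one X]
  simp only [preimmP_eq_sum_perm, sum_prod_ofFn_conjMat]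
end

section
/- The higher Capelli identity for preimmanants: in ℂS_p ⊗_ℂ End_ℂ(P) one has π(G°_p) = (1/p!²) Σ_{I∈{1,…,n}^p} Σ_{K∈{1,…,n'}^p} ( Σ_{σ∈S_p} σ ⊗ M_{i_{σ(p)},k_p} M_{i_{σ(p−1)},k_{p−1}} ⋯ M_{i_{σ(1)},k_1} ) · ( Σ_{σ'∈S_p} σ'⁻¹ ⊗ D_{i_{σ'(1)},k_1} D_{i_{σ'(2)},k_2} ⋯ D_{i_{σ'(p)},k_p} ). -/
open scoped TensorProduct

/-- The Jucys–Murphy element `x_k = Σ_{i<k} (i k) ∈ ℂS_p` (so `x_1 = 0`);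
here indices are 0-based. -/
noncomputable def jm {p : ℕ} (k : Fin p) : SA p :=
  ∑ i ∈ Finset.univ.filter (fun i : Fin p => i < k), perm (Equiv.swap i k)

/-- The polynomial algebra `P = ℂ[x_{ik} : 1≤i≤n, 1≤k≤n']`. -/
abbrev Pol (n n' : ℕ) := MvPolynomial (Fin n × Fin n') ℂ

/-- The multiplication operator `M_{ik}` by the variable `x_{ik}` on `P`. -/
noncomputable def Mop {n n' : ℕ} (i : Fin n) (k : Fin n') :
    Module.End ℂ (Pol n n') :=
  LinearMap.mulLeft ℂ (MvPolynomial.X (i, k))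

/-- The partial derivative operator `D_{ik} = ∂/∂x_{ik}` on `P`. -/
noncomputable def Dop {n n' : ℕ} (i : Fin n) (k : Fin n') :
    Module.End ℂ (Pol n n') :=
  (MvPolynomial.pderiv (i, k)).toLinearMap

/-- The polarization operator `P_{ij} = Σ_{k=1}^{n'} M_{ik} D_{jk}`. -/
noncomputable def Pop {n n' : ℕ} (i j : Fin n) : Module.End ℂ (Pol n n') :=
  ∑ k : Fin n', Mop i k * Dop j k

/-- `F_{ij}(−t) = 1⊗P_{ij} − δ_{ij}(t⊗id)` in `ℂS_p ⊗ End(P)`. -/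
noncomputable def FEneg {p n n' : ℕ} (i j : Fin n) (t : SA p) :
    SA p ⊗[ℂ] Module.End ℂ (Pol n n') :=
  (1 : SA p) ⊗ₜ[ℂ] Pop i j - if i = j then t ⊗ₜ[ℂ] (1 : Module.End ℂ (Pol n n')) else 0

/-- `π(G°_p) = (1/p!) Σ_{J∈[n]^p} Σ_{σ∈S_p}
F_{j_{σ(p)},j_p}(−x_p) ⋯ F_{j_{σ(1)},j_1}(−x_1) · (σ⁻¹⊗id)` in `ℂS_p ⊗ End(P)`. -/
noncomputable def piGpCirc (p n n' : ℕ) : SA p ⊗[ℂ] Module.End ℂ (Pol n n') :=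
  ((p.factorial : ℂ))⁻¹ • ∑ J : Fin p → Fin n, ∑ σ : Equiv.Perm (Fin p),
    (List.ofFn fun t : Fin p =>
      FEneg (J (σ t.rev)) (J t.rev) (jm t.rev)).prod *
      (perm σ⁻¹ ⊗ₜ[ℂ] (1 : Module.End ℂ (Pol n n')))

/-- The sandwich operator `X ↦ Σ_k M_{ak} X D_{bk}` on `End(P)`. -/
noncomputable def sandwich {n n' : ℕ} (ab : Fin n × Fin n) :
    Module.End ℂ (Pol n n') →ₗ[ℂ] Module.End ℂ (Pol n n') :=
  ∑ k : Fin n', LinearMap.mulLeft ℂ (Mop ab.1 k) ∘ₗ LinearMap.mulRight ℂ (Dop ab.2 k)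

theorem sandwich_apply {n n' : ℕ} (ab : Fin n × Fin n) (X : Module.End ℂ (Pol n n')) :
    sandwich ab X = ∑ k : Fin n', Mop ab.1 k * X * Dop ab.2 k := by
  simp [sandwich, LinearMap.sum_apply, mul_assoc]

theorem Mop_comm {n n' : ℕ} (i j : Fin n) (k l : Fin n') :
    Mop i k * Mop j l = Mop j l * Mop i k := by
  refine LinearMap.ext fun f => ?_
  simp only [Mop, Module.End.mul_apply, LinearMap.mulLeft_apply]
  ring

theorem pderiv_comm {σ R : Type*} [CommSemiring R] (i j : σ) (f : MvPolynomial σ R) :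
    MvPolynomial.pderiv i (MvPolynomial.pderiv j f) =
      MvPolynomial.pderiv j (MvPolynomial.pderiv i f) := by
  classical
  induction f using MvPolynomial.induction_on with
  | C a => simp
  | add p q hp hq => simp [hp, hq]
  | mul_X p m hp =>
    simp only [Derivation.leibniz, MvPolynomial.pderiv_X, smul_eq_mul, map_add, hp,
      Pi.single_apply]
    split_ifs <;> simp <;> ring

theorem Dop_comm {n n' : ℕ} (i j : Fin n) (k l : Fin n') :
    (Dop i k * Dop j l : Module.End ℂ (Pol n n')) = Dop j l * Dop i k := by
  refine LinearMap.ext fun f => ?_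
  exact pderiv_comm _ _ f

theorem Dop_mul_Mop {n n' : ℕ} (i j : Fin n) (k l : Fin n') :
    (Dop i k * Mop j l : Module.End ℂ (Pol n n')) =
      Mop j l * Dop i k + if i = j ∧ k = l then 1 else 0 := by
  refine LinearMap.ext fun f => ?_
  simp only [Mop, Dop, Module.End.mul_apply, LinearMap.mulLeft_apply, LinearMap.add_apply,
    Derivation.coeFn_coe, Derivation.leibniz, MvPolynomial.pderiv_X, Pi.single_apply,
    Prod.mk.injEq, smul_eq_mul, eq_comm (a := j), eq_comm (a := l)]
  split_ifs <;> simp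

theorem Pop_mul_Mop {n n' : ℕ} (i j a : Fin n) (k : Fin n') :
    (Pop i j * Mop a k : Module.End ℂ (Pol n n')) =
      Mop a k * Pop i j + if j = a then Mop i k else 0 := by
  simp only [Pop, Finset.sum_mul, Finset.mul_sum, mul_assoc, Dop_mul_Mop, mul_add,
    Finset.sum_add_distrib]
  congr 1
  · exact Finset.sum_congr rfl fun l _ => by rw [← mul_assoc, Mop_comm, mul_assoc]
  · by_cases h : j = a <;> simp [h]

theorem sandwich_comm {n n' : ℕ} (ab cd : Fin n × Fin n) (X : Module.End ℂ (Pol n n')) :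
    sandwich ab (sandwich cd X) = sandwich cd (sandwich ab X) := by
  simp only [sandwich_apply, Finset.mul_sum, Finset.sum_mul]
  rw [Finset.sum_comm]
  refine Finset.sum_congr rfl fun l _ => Finset.sum_congr rfl fun k _ => ?_
  rw [← mul_assoc, ← mul_assoc, ← mul_assoc, ← mul_assoc, Mop_comm, mul_assoc _ (Dop _ _),
    mul_assoc _ (Dop _ _), Dop_comm]

theorem Pop_mul_sandwich {n n' : ℕ} (i j a b : Fin n) (X : Module.End ℂ (Pol n n')) :
    Pop i j * sandwich (a, b) X =
      sandwich (a, b) (Pop i j * X) + if j = a then sandwich (i, b) X else 0 := by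
  simp only [sandwich_apply, Finset.mul_sum, ← mul_assoc, Pop_mul_Mop, add_mul,
    Finset.sum_add_distrib]
  congr 1
  split_ifs <;> simp

instance {n n' : ℕ} : LeftCommutative
    (fun (ab : Fin n × Fin n) (X : Module.End ℂ (Pol n n')) => sandwich ab X) :=
  ⟨sandwich_comm⟩

/-- The normally ordered product `:Π P_{ab}:` over a multiset of pairs `(a, b)`. -/
noncomputable def normalProd {n : ℕ} (n' : ℕ) (m : Multiset (Fin n × Fin n)) :
    Module.End ℂ (Pol n n') :=
  m.foldr (fun ab X => sandwich ab X) 1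

theorem normalProd_cons {n : ℕ} (n' : ℕ) (ab : Fin n × Fin n) (m : Multiset (Fin n × Fin n)) :
    normalProd n' (ab ::ₘ m) = sandwich ab (normalProd n' m) := by
  simp [normalProd]

theorem Pop_mul_normalProd {ι : Type*} [DecidableEq ι] {n n' : ℕ} (i j : Fin n) (T : Finset ι)
    (g : ι → Fin n × Fin n) :
    Pop i j * normalProd n' (T.val.map g) =
      normalProd n' ((i, j) ::ₘ T.val.map g) +
        ∑ s ∈ T, if j = (g s).1 then
          normalProd n' ((i, (g s).2) ::ₘ (T.erase s).val.map g) else 0 := by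
  induction T using Finset.induction_on with
  | empty => simp [normalProd, sandwich_apply, Pop]
  | insert u T hu ih =>
    rw [Finset.sum_insert hu, Finset.erase_insert hu, Finset.insert_val_of_notMem hu,
      Multiset.map_cons, normalProd_cons n' (g u), Pop_mul_sandwich, ih, map_add, map_sum]
    simp only [normalProd_cons, Prod.mk.eta]
    rw [sandwich_comm, add_assoc, add_comm (Finset.sum _ _)]
    congr 2
    refine Finset.sum_congr rfl fun s hs => ?_
    have hsu : u ≠ s := fun h => hu (h ▸ hs)
    rw [Finset.erase_insert_of_ne hsu,
      Finset.insert_val_of_notMem (fun h => hu (Finset.mem_of_mem_erase h)), Multiset.map_cons,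
      normalProd_cons, sandwich_comm]
    split_ifs <;> simp

theorem sum_Mop_prod_mul_Dop_prod {n n' p : ℕ} (g : Fin p → Fin n × Fin n) :
    ∑ K : Fin p → Fin n', (List.ofFn fun t : Fin p => Mop (g t.rev).1 (K t.rev)).prod *
      (List.ofFn fun t : Fin p => Dop (g t).2 (K t)).prod =
      normalProd n' (Finset.univ.val.map g) := by
  induction p with
  | zero => simp [normalProd]
  | succ p ih =>
    have h : (Finset.univ : Finset (Fin (p + 1))).val.map g =
        g (Fin.last p) ::ₘ Finset.univ.val.map fun t : Fin p => g t.castSucc := by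
      rw [Fin.univ_castSuccEmb]
      simp [Function.comp_def]
    rw [h, normalProd_cons, ← ih, map_sum]
    simp only [sandwich_apply]
    rw [← (Fin.snocEquiv fun _ => Fin n').sum_comp, Fintype.sum_prod_type, Finset.sum_comm]
    refine Finset.sum_congr rfl fun K _ => Finset.sum_congr rfl fun k _ => ?_
    simp only [List.ofFn_succ (f := fun t : Fin (p + 1) => Mop _ _), List.prod_cons,
      Fin.rev_zero, Fin.rev_succ]
    rw [List.ofFn_succ', List.concat_eq_append, List.prod_append]
    simp [Fin.snocEquiv, mul_assoc]

theorem perm_mul {p : ℕ} (σ τ : Equiv.Perm (Fin p)) : perm (σ * τ) = perm σ * perm τ :=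
  map_mul _ σ τ

theorem sum_FEneg_prod {p n n' : ℕ} (J : Fin p → Fin n) (q : ℕ) (hq : q ≤ p)
    (L : Equiv.Perm (Fin p) → SA p ⊗[ℂ] Module.End ℂ (Pol n n'))
    (hL : ∀ σ a b, a.val < q → b.val < q → L (σ * Equiv.swap a b) = L σ) :
    ∑ σ : Equiv.Perm (Fin p), L σ * (List.ofFn fun t : Fin q =>
      FEneg (n' := n') (J (σ (t.rev.castLE hq))) (J (t.rev.castLE hq))
        (jm (t.rev.castLE hq))).prod * (perm σ⁻¹ ⊗ₜ[ℂ] 1) =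
    ∑ σ : Equiv.Perm (Fin p), L σ * (perm σ⁻¹ ⊗ₜ[ℂ]
      normalProd n' ((Finset.univ.filter fun t : Fin p => t.val < q).val.map
        fun t => (J (σ t), J t))) := by
  induction q generalizing L with
  | zero => simp [normalProd]
  | succ q ih =>
    set u : Fin p := ⟨q, hq⟩ with hu
    set T : Finset (Fin p) := Finset.univ.filter fun t : Fin p => t.val < q with hT
    have huT : u ∉ T := by simp [hT, hu]
    have hT' : (Finset.univ.filter fun t : Fin p => t.val < q + 1) = insert u T := by
      ext t
      simp [hT, hu, Fin.ext_iff]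
      omega
    have hjm : (jm u : SA p) = ∑ s ∈ T, perm (Equiv.swap s u) := rfl
    rw [hT']
    have key := ih (by omega) (fun σ => L σ * FEneg (n' := n') (J (σ u)) (J u) (jm u)) (by
      intro σ a b ha hb
      have h : (σ * Equiv.swap a b) u = σ u := by
        rw [Equiv.Perm.mul_apply, Equiv.swap_apply_of_ne_of_ne] <;>
          simp only [hu, ne_eq, Fin.ext_iff] <;> omega
      simp only [h, hL σ a b (by omega) (by omega)])
    have hl : ∀ σ : Equiv.Perm (Fin p), L σ * (List.ofFn fun t : Fin (q + 1) =>
        FEneg (n' := n') (J (σ (t.rev.castLE hq))) (J (t.rev.castLE hq))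
          (jm (t.rev.castLE hq))).prod =
        L σ * FEneg (J (σ u)) (J u) (jm u) * (List.ofFn fun t : Fin q =>
        FEneg (n' := n') (J (σ (t.rev.castLE (by omega)))) (J (t.rev.castLE (by omega)))
          (jm (t.rev.castLE (by omega)))).prod := by
      intro σ
      rw [List.ofFn_succ, List.prod_cons, ← mul_assoc]
      simp only [Fin.rev_zero, Fin.rev_succ]
      rfl
    simp only [hl]
    rw [key]
    have hF : ∀ σ : Equiv.Perm (Fin p), L σ * FEneg (J (σ u)) (J u) (jm u) *
        (perm σ⁻¹ ⊗ₜ[ℂ] normalProd n' (T.val.map fun t => (J (σ t), J t))) =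
        L σ * (perm σ⁻¹ ⊗ₜ[ℂ] normalProd n' ((insert u T).val.map fun t => (J (σ t), J t))) +
        ∑ s ∈ T, L σ * (perm σ⁻¹ ⊗ₜ[ℂ] if J u = J (σ s) then normalProd n' ((J (σ u), J s) ::ₘ
          (T.erase s).val.map fun t => (J (σ t), J t)) else 0) -
        ∑ s ∈ T, L σ * (perm (Equiv.swap s u * σ⁻¹) ⊗ₜ[ℂ] if J (σ u) = J u then
          normalProd n' ((J (σ s), J s) ::ₘ
          (T.erase s).val.map fun t => (J (σ t), J t)) else 0) := by
      intro σ
      have hs : ∀ s ∈ T, ((J (σ s), J s) ::ₘ (T.erase s).val.map fun t => (J (σ t), J t)) =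
          T.val.map fun t => (J (σ t), J t) := by
        intro s hs
        rw [← Multiset.map_cons (fun t => (J (σ t), J t)), Finset.erase_val,
          Multiset.cons_erase hs]
      rw [mul_assoc, ← Finset.mul_sum, ← Finset.mul_sum, ← mul_add, ← mul_sub]
      congr 1
      rw [FEneg, sub_mul, Algebra.TensorProduct.tmul_mul_tmul, one_mul, Pop_mul_normalProd,
        TensorProduct.tmul_add, TensorProduct.tmul_sum, Finset.insert_val_of_notMem huT,
        Multiset.map_cons]
      refine congrArg₂ (· - ·) rfl ?_
      split_ifs with h
      · rw [Algebra.TensorProduct.tmul_mul_tmul, one_mul, hjm, Finset.sum_mul,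
          TensorProduct.sum_tmul]
        exact Finset.sum_congr rfl fun s h => by rw [hs s h, perm_mul]
      · simp
    simp only [hF, Finset.sum_sub_distrib, Finset.sum_add_distrib]
    rw [add_sub_assoc, add_eq_left, sub_eq_zero, Finset.sum_comm,
      Finset.sum_comm (s := Finset.univ)]
    refine Finset.sum_congr rfl fun s hs => ?_
    have hsq : s.val < q := by simpa [hT] using hs
    rw [← Equiv.sum_comp (Equiv.mulRight (Equiv.swap s u))]
    refine Finset.sum_congr rfl fun σ _ => ?_
    have hm : ((T.erase s).val.map fun t => (J ((σ * Equiv.swap s u) t), J t)) =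
        (T.erase s).val.map fun t => (J (σ t), J t) := by
      refine Multiset.map_congr rfl fun t ht => ?_
      have ht' : t ∈ T.erase s := ht
      rw [Equiv.Perm.mul_apply, Equiv.swap_apply_of_ne_of_ne (Finset.ne_of_mem_erase ht')
        (ne_of_mem_of_not_mem (Finset.mem_of_mem_erase ht') huT)]
    rw [Equiv.coe_mulRight, hm, hL σ s u (by omega) (by simp [hu]), mul_inv_rev,
      Equiv.swap_inv]
    simp [eq_comm]

/-- The fully contracted normally ordered product attached to a permutation. -/
noncomputable def normalTrace {p : ℕ} (n n' : ℕ) (ρ : Equiv.Perm (Fin p)) :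
    Module.End ℂ (Pol n n') :=
  ∑ I : Fin p → Fin n, normalProd n' (Finset.univ.val.map fun t => (I (ρ t), I t))

theorem sum_normalProd_eq_normalTrace {p : ℕ} (n n' : ℕ) (σ τ : Equiv.Perm (Fin p)) :
    ∑ I : Fin p → Fin n, normalProd n' (Finset.univ.val.map fun t => (I (σ t), I (τ t))) =
      normalTrace n n' (σ * τ⁻¹) := by
  refine Finset.sum_congr rfl fun I _ => ?_
  rw [← Multiset.map_univ_val_equiv τ⁻¹, Multiset.map_map]
  simp

theorem normalTrace_conj {p : ℕ} (n n' : ℕ) (ρ τ : Equiv.Perm (Fin p)) :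
    normalTrace n n' (τ * ρ * τ⁻¹) = normalTrace n n' ρ := by
  rw [← sum_normalProd_eq_normalTrace, normalTrace]
  exact (τ.arrowCongr (Equiv.refl (Fin n))).symm.sum_comp fun I : Fin p → Fin n =>
    normalProd n' (Finset.univ.val.map fun t => (I (ρ t), I t))

theorem normalTrace_inv {p : ℕ} (n n' : ℕ) (ρ : Equiv.Perm (Fin p)) :
    normalTrace n n' ρ⁻¹ = normalTrace n n' ρ := by
  obtain ⟨τ, h⟩ := isConj_iff.1 (Equiv.Perm.isConj_of_cycleType_eq (Equiv.Perm.cycleType_inv ρ))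
  rw [← normalTrace_conj n n' ρ⁻¹ τ, h]

theorem piGpCirc_eq {p n n' : ℕ} :
    piGpCirc p n n' = (p.factorial : ℂ)⁻¹ •
      ∑ σ : Equiv.Perm (Fin p), perm σ ⊗ₜ[ℂ] normalTrace n n' σ := by
  rw [piGpCirc]
  congr 1
  have h (J : Fin p → Fin n) := sum_FEneg_prod (n' := n') J p le_rfl (fun _ => 1) (by simp)
  simp only [one_mul, Fin.castLE_rfl, id, Fin.is_lt, Finset.filter_true] at h
  rw [Finset.sum_congr rfl fun J _ => h J, Finset.sum_comm, ← Equiv.sum_comp (Equiv.inv _)]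
  simp only [← TensorProduct.tmul_sum, Equiv.inv_apply, inv_inv]
  exact Finset.sum_congr rfl fun σ _ => by rw [← normalTrace_inv]; rfl

/-- The higher Capelli identity for preimmanants, in `ℂS_p ⊗ End(P)`:
`π(G°_p) = (1/p!²) Σ_{I∈[n]^p} Σ_{K∈[n']^p}
  (Σ_σ σ ⊗ M_{i_{σ(p)},k_p} ⋯ M_{i_{σ(1)},k_1}) ·
  (Σ_σ' σ'⁻¹ ⊗ D_{i_{σ'(1)},k_1} ⋯ D_{i_{σ'(p)},k_p})`. -/
theorem stmt18 {p n n' : ℕ} :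
    piGpCirc p n n' =
      (((p.factorial : ℂ)) ^ 2)⁻¹ •
        ∑ I : Fin p → Fin n, ∑ K : Fin p → Fin n',
          (∑ σ : Equiv.Perm (Fin p),
            perm σ ⊗ₜ[ℂ]
              (List.ofFn fun t : Fin p => Mop (I (σ t.rev)) (K t.rev)).prod) *
          (∑ σ' : Equiv.Perm (Fin p),
            perm σ'⁻¹ ⊗ₜ[ℂ]
              (List.ofFn fun t : Fin p => Dop (I (σ' t)) (K t)).prod) := by
  have h : ∑ I : Fin p → Fin n, ∑ K : Fin p → Fin n',
      (∑ σ : Equiv.Perm (Fin p), perm σ ⊗ₜ[ℂ]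
        (List.ofFn fun t : Fin p => Mop (I (σ t.rev)) (K t.rev)).prod) *
      (∑ σ' : Equiv.Perm (Fin p), perm σ'⁻¹ ⊗ₜ[ℂ]
        (List.ofFn fun t : Fin p => Dop (I (σ' t)) (K t)).prod) =
      ∑ σ' : Equiv.Perm (Fin p), ∑ σ : Equiv.Perm (Fin p),
        perm (σ * σ'⁻¹) ⊗ₜ[ℂ] normalTrace n n' (σ * σ'⁻¹) := by
    simp only [← sum_normalProd_eq_normalTrace, ← sum_Mop_prod_mul_Dop_prod,
      TensorProduct.tmul_sum, Finset.sum_mul_sum, Algebra.TensorProduct.tmul_mul_tmul, perm_mul]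
    simp only [← Fintype.sum_prod_type']
    let e : (Fin p → Fin n) × (Fin p → Fin n') × Equiv.Perm (Fin p) × Equiv.Perm (Fin p) ≃
        Equiv.Perm (Fin p) × Equiv.Perm (Fin p) × (Fin p → Fin n) × (Fin p → Fin n') :=
      { toFun := fun x => (x.2.2.2, x.2.2.1, x.1, x.2.1)
        invFun := fun x => (x.2.2.1, x.2.2.2, x.2.1, x.1) }
    rw [← Equiv.sum_comp e]
    exact Finset.sum_congr rfl fun x _ => by simp only [e, Equiv.coe_fn_mk]
  have h' (σ' : Equiv.Perm (Fin p)) := Equiv.sum_comp (Equiv.mulRight σ'⁻¹) fun σ =>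
    (perm σ ⊗ₜ[ℂ] normalTrace n n' σ : SA p ⊗[ℂ] Module.End ℂ (Pol n n'))
  simp only [Equiv.coe_mulRight] at h'
  rw [h, piGpCirc_eq, Finset.sum_congr rfl fun σ' _ => h' σ', Finset.sum_const,
    Finset.card_univ, Fintype.card_perm, Fintype.card_fin, ← Nat.cast_smul_eq_nsmul ℂ, smul_smul]
  congr 1
  have := Nat.cast_ne_zero (R := ℂ).2 p.factorial_ne_zero
  field_simp
end
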